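/- Fix a positive integer p and a real number t ∈ (0,∞). Then, as n → ∞, P{ (H_{n,p}+1)/√n ≤ t } = (2^{−C(p,2)} / Π_{j=0}^{p−1} j!) · det_{0≤i,j<p}( (−1)^i H_{i+j}(0) − H_{i+j}(t) e^{−t²} ) + O( n^{−1/2} e^{−t²} ), where C(p,2) = p(p−1)/2. -/

import Mathlib

open scoped BigOperators
open Filter

/-- Binomial coefficient with integer lower argument, `0` outside range. -/
def ichoose (a : ℕ) (b : ℤ) : ℕ := if 0 ≤ b then a.choose b.toNat else 0

/-- A `p`-watermelon of length `2n` (no wall): the `i`-th branch starts at `(0,2i)`,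
ends at `(2n,2i)`, takes steps `(1,1)` or `(1,-1)`, and no two branches share a point.
`y i t` is the ordinate of the `i`-th branch at abscissa `t`. -/
def IsMelon (p n : ℕ) (y : Fin p → Fin (2*n+1) → ℤ) : Prop :=
  (∀ i, y i 0 = 2 * (i : ℤ)) ∧
  (∀ i, y i (Fin.last (2*n)) = 2 * (i : ℤ)) ∧
  (∀ i (t : Fin (2*n)), y i t.succ - y i t.castSucc = 1 ∨ y i t.succ - y i t.castSucc = -1) ∧
  (∀ i j, i ≠ j → ∀ t, y i t ≠ y j t)

/-- The height of a watermelon: the maximal ordinate reached (by its top-most branch). -/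
noncomputable def melonHeight {p n : ℕ} (y : Fin p → Fin (2*n+1) → ℤ) : ℤ :=
  sSup {v | ∃ i t, y i t = v}

/-- The depth of a watermelon: the minimal ordinate reached (by its bottom-most branch). -/
noncomputable def melonDepth {p n : ℕ} (y : Fin p → Fin (2*n+1) → ℤ) : ℤ :=
  sInf {v | ∃ i t, y i t = v}

/-- The range of a watermelon: height minus depth. -/
noncomputable def melonRange {p n : ℕ} (y : Fin p → Fin (2*n+1) → ℤ) : ℤ :=
  melonHeight y - melonDepth y

/-- The `k`-th physicists' Hermite polynomial, via
`H_k(z)/k! = Σ_m ((-1)^(k-m)/(k-m)!) (2z)^(2m-k)/(2m-k)!` (terms with negative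
factorial arguments being zero). -/
noncomputable def hermiteH (k : ℕ) (z : ℝ) : ℝ :=
  (k.factorial : ℝ) * ∑ m ∈ Finset.range (k+1),
    if k ≤ 2*m then ((-1:ℝ)^(k-m) / (k-m).factorial) * ((2*z)^(2*m-k) / (2*m-k).factorial)
    else 0


/-- Families of nonintersecting paths with allowed set `b`. -/
def Fam (p : ℕ) (b : ℤ → Prop) (e : Fin p → ℤ) (T : ℕ) (x : Fin p → ℤ)
    (y : Fin p → Fin (T+1) → ℤ) : Prop :=
  (∀ i, y i 0 = x i) ∧ (∀ i, y i (Fin.last T) = e i) ∧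
  (∀ i (t : Fin T), y i t.succ - y i t.castSucc = 1 ∨ y i t.succ - y i t.castSucc = -1) ∧
  (∀ i j, i ≠ j → ∀ t, y i t ≠ y j t) ∧ (∀ i t, b (y i t))

def sgnB (s : Bool) : ℤ := if s then 1 else -1

lemma sgnB_inj : Function.Injective sgnB := by
  intro a b h
  cases a <;> cases b <;> simp [sgnB] at h ⊢

lemma fam_step (p : ℕ) (b : ℤ → Prop) (e : Fin p → ℤ) (T : ℕ) (x : Fin p → ℤ)
    (hx : ∀ i j, i ≠ j → x i ≠ x j) (hb : ∀ i, b (x i)) :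
    Nonempty ((Σ ε : Fin p → Bool, {y // Fam p b e T (fun i => x i + sgnB (ε i)) y}) ≃
      {y // Fam p b e (T+1) x y}) := by
  refine ⟨Equiv.ofBijective (fun z => ⟨fun i => Fin.cons (x i) (z.2.1 i), ?_⟩) ⟨?_, ?_⟩⟩
  · obtain ⟨ε, z, h1, h2, h3, h4, h5⟩ := z
    refine ⟨fun i => by simp, fun i => ?_, fun i t => ?_, fun i j hij t => ?_, fun i t => ?_⟩
    · rw [← Fin.succ_last]; exact h2 i
    · refine Fin.cases ?_ (fun t => ?_) t
      · simp only [Fin.castSucc_zero, Fin.cons_zero, Fin.cons_succ, h1]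
        cases ε i <;> simp [sgnB]
      · rw [← Fin.succ_castSucc]
        exact h3 i t
    · refine Fin.cases ?_ (fun t => ?_) t
      · simpa using hx i j hij
      · simpa using h4 i j hij t
    · refine Fin.cases ?_ (fun t => ?_) t
      · simpa using hb i
      · simpa using h5 i t
  · rintro ⟨ε, z, hz⟩ ⟨ε', z', hz'⟩ h
    have h0 : ∀ i, (Fin.cons (x i) (z i) : Fin (T+1+1) → ℤ) = Fin.cons (x i) (z' i) := by
      intro i
      exact congrFun (congrArg Subtype.val h) i
    have h1 : z = z' := by
      funext i
      exact Fin.cons_right_injective (α := fun _ => ℤ) (x i) (h0 i)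
    subst h1
    have h2 : ε = ε' := by
      funext i
      have a := hz.1 i
      have b := hz'.1 i
      apply sgnB_inj
      simp only at a b
      omega
    subst h2
    rfl
  · rintro ⟨y, h1, h2, h3, h4, h5⟩
    refine ⟨⟨fun i => decide (y i 1 - y i 0 = 1), fun i => Fin.tail (y i), ?_, ?_, ?_, ?_, ?_⟩, ?_⟩
    · intro i
      have := h3 i 0
      simp only [Fin.succ_zero_eq_one, Fin.castSucc_zero, h1] at this
      simp only [Fin.tail, Fin.succ_zero_eq_one, h1, sgnB, decide_eq_true_eq]
      split_ifs <;> omega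
    · intro i
      simpa [Fin.tail] using h2 i
    · intro i t
      have := h3 i t.succ
      simpa [Fin.tail, ← Fin.succ_castSucc] using this
    · intro i j hij t
      exact h4 i j hij _
    · intro i t
      exact h5 i _
    · apply Subtype.ext
      funext i
      simp only
      rw [← h1 i]
      exact Fin.cons_self_tail (α := fun _ => ℤ) (y i)

lemma det_base (p : ℕ) (e x : Fin p → ℤ) (he : StrictMono e) (hx : StrictMono x) :
    Matrix.det (Matrix.of fun i j : Fin p => if x i = e j then (1:ℝ) else 0) =
      if x = e then 1 else 0 := by
  split_ifs with h
  · subst h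
    have : (Matrix.of fun i j : Fin p => if x i = x j then (1:ℝ) else 0) = 1 := by
      ext i j
      simp [Matrix.one_apply, hx.injective.eq_iff]
    rw [this, Matrix.det_one]
  · by_contra hd
    apply h
    have h1 : ∀ i, ∃ j, x i = e j := by
      intro i
      by_contra hc
      push Not at hc
      apply hd
      apply Matrix.det_eq_zero_of_row_eq_zero i
      intro j
      simp [hc j]
    choose σ hσ using h1
    have hinj : Function.Injective σ := by
      intro i j hij
      apply hx.injective
      rw [hσ, hσ, hij]
    have hs := Finite.surjective_of_injective hinj
    apply (StrictMono.range_inj hx he).mp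
    ext v
    constructor
    · rintro ⟨i, rfl⟩; exact ⟨σ i, (hσ i).symm⟩
    · rintro ⟨i, rfl⟩
      obtain ⟨j, rfl⟩ := hs i
      exact ⟨j, hσ j⟩

theorem fam_count (p : ℕ) (b : ℤ → Prop) (e : Fin p → ℤ) (he : StrictMono e)
    (w : ℕ → ℤ → Fin p → ℝ)
    (hw : ∀ T x j, w (T+1) x j = w T (x+1) j + w T (x-1) j)
    (hb1 : ∀ x, b x → b (x+1) ∨ ∀ T j, w T (x+1) j = 0)
    (hb2 : ∀ x, b x → b (x-1) ∨ ∀ T j, w T (x-1) j = 0)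
    (h0 : ∀ x j, b x → w 0 x j = if x = e j then 1 else 0) (T : ℕ) :
    ∀ x : Fin p → ℤ, StrictMono x → (∀ i j, (2:ℤ) ∣ x i - x j) → (∀ i, b (x i)) →
      Finite {y // Fam p b e T x y} ∧
      (Nat.card {y // Fam p b e T x y} : ℝ) = Matrix.det (Matrix.of fun i j => w T (x i) j) := by
  induction T with
  | zero =>
    intro x hx _ hb
    have h1 : (Matrix.of fun i j : Fin p => w 0 (x i) j) =
        Matrix.of fun i j : Fin p => if x i = e j then (1:ℝ) else 0 := by
      ext i j
      simp [h0 _ _ (hb i)]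
    rw [h1, det_base p e x he hx]
    have hsub : Subsingleton {y // Fam p b e 0 x y} := by
      constructor
      rintro ⟨y, hy⟩ ⟨z, hz⟩
      apply Subtype.ext
      funext i t
      obtain rfl : t = 0 := Fin.fin_one_eq_zero t
      simp only
      rw [hy.1, hz.1]
    refine ⟨inferInstance, ?_⟩
    split_ifs with h
    · have : Nonempty {y // Fam p b e 0 x y} := by
        refine ⟨fun i _ => x i, fun i => rfl, fun i => by rw [h], fun i t => t.elim0, ?_, ?_⟩
        · intro i j hij t
          exact fun hh => hij (hx.injective hh)
        · intro i t; exact hb i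
      rw [Nat.card_eq_one_iff_unique.mpr ⟨hsub, this⟩]
      simp
    · have : IsEmpty {y // Fam p b e 0 x y} := by
        constructor
        rintro ⟨y, hy⟩
        apply h
        funext i
        rw [← hy.1 i, ← hy.2.1 i]
        rfl
      simp
  | succ T ih =>
    intro x hx hpar hb
    have key : ∀ ε : Fin p → Bool, Finite {y // Fam p b e T (fun i => x i + sgnB (ε i)) y} ∧
        (Nat.card {y // Fam p b e T (fun i => x i + sgnB (ε i)) y} : ℝ) =
          Matrix.det (Matrix.of fun i j => w T (x i + sgnB (ε i)) j) := by
      intro ε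
      by_cases hbb : ∀ i, b (x i + sgnB (ε i))
      · by_cases hinj : Function.Injective (fun i => x i + sgnB (ε i))
        · apply ih _ _ _ hbb
          · apply Monotone.strictMono_of_injective _ hinj
            intro i j hij
            rcases hij.eq_or_lt with rfl | hlt
            · exact le_rfl
            have := hx hlt
            obtain ⟨k, hk⟩ := hpar j i
            simp only [sgnB]
            split_ifs <;> omega
          · intro i j
            have := hpar i j
            simp only [sgnB]
            split_ifs <;> omega
        · rw [Function.not_injective_iff] at hinj
          obtain ⟨i, j, hij, hne⟩ := hinj
          have : IsEmpty {y // Fam p b e T (fun i => x i + sgnB (ε i)) y} := by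
            constructor
            rintro ⟨y, hy⟩
            apply hy.2.2.2.1 i j hne 0
            rw [hy.1, hy.1]; exact hij
          refine ⟨inferInstance, ?_⟩
          rw [Matrix.det_zero_of_row_eq hne]
          · simp
          · funext k
            simp only [Matrix.of_apply]
            exact congrArg (fun v => w T v k) hij
      · push Not at hbb
        obtain ⟨i, hi⟩ := hbb
        have : IsEmpty {y // Fam p b e T (fun i => x i + sgnB (ε i)) y} := by
          constructor
          rintro ⟨y, hy⟩
          apply hi
          have := hy.2.2.2.2 i 0
          rwa [hy.1] at this
        refine ⟨inferInstance, ?_⟩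
        rw [Matrix.det_eq_zero_of_row_eq_zero i]
        · simp
        · intro j
          simp only [Matrix.of_apply]
          revert hi
          cases ε i
          · intro hi
            rcases hb2 _ (hb i) with h | h
            · exact absurd h hi
            · exact h T j
          · intro hi
            rcases hb1 _ (hb i) with h | h
            · exact absurd h hi
            · exact h T j
    obtain ⟨E⟩ := fam_step p b e T x (fun i j hij h => hij (hx.injective h)) hb
    have : ∀ ε : Fin p → Bool, Finite {y // Fam p b e T (fun i => x i + sgnB (ε i)) y} :=
      fun ε => (key ε).1
    refine ⟨Finite.of_equiv _ E, ?_⟩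
    rw [← Nat.card_congr E, Nat.card_sigma]
    push_cast
    rw [Finset.sum_congr rfl (fun ε _ => (key ε).2)]
    have h2 : (Matrix.of fun i j => w (T+1) (x i) j) =
        fun i => ∑ s : Bool, (fun j => w T (x i + sgnB s) j) := by
      funext i j
      simp [hw, sgnB, sub_eq_add_neg]
    have h3 := (Matrix.detRowAlternating (n := Fin p) (R := ℝ)).toMultilinearMap.map_sum
      (fun i (s : Bool) => (fun j => w T (x i + sgnB s) j))
    rw [h2]
    exact h3.symm

/-- number of ±1 walks -/
noncomputable def wc : ℕ → ℤ → ℝ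
  | 0, d => if d = 0 then 1 else 0
  | T+1, d => wc T (d-1) + wc T (d+1)

lemma wc_even (T : ℕ) : ∀ d, wc T (-d) = wc T d := by
  induction T with
  | zero => intro d; simp [wc]
  | succ T ih =>
    intro d
    rw [wc, wc, ← ih (d-1), ← ih (d+1)]
    rw [add_comm]; ring_nf

lemma wc_nonneg (T : ℕ) : ∀ d, 0 ≤ wc T d := by
  induction T with
  | zero => intro d; simp only [wc]; split_ifs <;> norm_num
  | succ T ih => intro d; rw [wc]; have := ih (d-1); have := ih (d+1); linarith

lemma wc_pos (n : ℕ) : 0 < wc (2*n) 0 := by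
  induction n with
  | zero => simp [wc]
  | succ n ih =>
    have h : wc (2*(n+1)) 0 = wc (2*n) (-2) + wc (2*n) 0 + (wc (2*n) 0 + wc (2*n) 2) := by
      show wc (2*n+1+1) 0 = _
      simp only [wc]; norm_num
    have h1 := wc_nonneg (2*n) (-2)
    have h2 := wc_nonneg (2*n) 2
    linarith

lemma wc_rec (T : ℕ) : ∀ d : ℤ, ((T:ℝ)+d+2) * wc T (d+2) = ((T:ℝ)-d) * wc T d := by
  induction T with
  | zero =>
    intro d
    simp only [wc]
    by_cases h : d = 0
    · subst h; norm_num
    · by_cases h' : d + 2 = 0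
      · have : (d:ℝ) + 2 = 0 := by exact_mod_cast h'
        simp [h, this]
      · simp [h, h']
  | succ T ih =>
    intro d
    have h1 := ih (d+1)
    have h2 := ih (d-1)
    simp only [wc]
    rw [show d + 2 - 1 = d + 1 by ring, show d+2+1 = d+1+2 by ring]
    rw [show d - 1 + 2 = d + 1 by ring] at h2
    push_cast at *
    linear_combination h1 + h2

/-- count of melons under the ceiling `h` -/
lemma count_h (p n : ℕ) (h : ℤ) (hh : 2 * (p:ℤ) ≤ h) :
    (Nat.card {y : Fin p → Fin (2*n+1) → ℤ // IsMelon p n y ∧ ∀ i t, y i t < h} : ℝ) =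
     Matrix.det (Matrix.of fun i j : Fin p =>
       wc (2*n) (2*((i:ℤ)-(j:ℤ))) - wc (2*n) (2*(h-i-j))) := by
  have hlt : ∀ i : Fin p, 2 * (i:ℤ) < h := by
    intro i; have := i.2; omega
  have hsm : StrictMono (fun i : Fin p => 2 * (i:ℤ)) := by
    intro i j hij
    have : (i:ℕ) < j := hij
    simp only; omega
  have := (fam_count p (fun v => v < h) (fun i => 2 * (i:ℤ)) hsm
    (fun T x j => wc T (x - 2 * (j:ℤ)) - wc T (2*h - 2*(j:ℤ) - x)) ?_ ?_ ?_ ?_ (2*n)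
    (fun i => 2 * (i:ℤ)) hsm ?_ hlt).2
  · convert this using 2
    · apply Nat.card_congr
      apply Equiv.subtypeEquivRight
      intro y
      simp only [IsMelon, Fam, and_assoc]
    · ext i j
      simp only [Matrix.of_apply]
      congr 2 <;> ring
  · intro T x j
    simp only [wc]
    ring_nf
  · intro x hx
    by_cases hx' : x + 1 < h
    · exact Or.inl hx'
    · right
      intro T j
      have : x + 1 = h := by omega
      rw [this]; ring_nf
  · intro x hx
    left; omega
  · intro x j hx
    have := hlt j
    simp only [wc]
    rw [if_neg (show ¬ (2*h - 2*(j:ℤ) - x = 0) by omega)]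
    simp [sub_eq_zero]
  · intro i j
    exact ⟨(i:ℤ)-j, by ring⟩

lemma count_all (p n : ℕ) :
    (Nat.card {y : Fin p → Fin (2*n+1) → ℤ // IsMelon p n y} : ℝ) =
     Matrix.det (Matrix.of fun i j : Fin p => wc (2*n) (2*((i:ℤ)-(j:ℤ)))) := by
  have hsm : StrictMono (fun i : Fin p => 2 * (i:ℤ)) := by
    intro i j hij
    have : (i:ℕ) < j := hij
    simp only; omega
  have := (fam_count p (fun v => True) (fun i => 2 * (i:ℤ)) hsm
    (fun T x j => wc T (x - 2 * (j:ℤ))) ?_ ?_ ?_ ?_ (2*n)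
    (fun i => 2 * (i:ℤ)) hsm ?_ (fun _ => trivial)).2
  · convert this using 2
    · apply Nat.card_congr
      apply Equiv.subtypeEquivRight
      intro y
      simp only [IsMelon, Fam, implies_true, and_true]
    · ext i j
      simp only [Matrix.of_apply]
      congr 1; ring
  · intro T x j
    simp only [wc]
    ring_nf
  · simp
  · simp
  · intro x j hx
    simp [wc, sub_eq_zero]
  · intro i j
    exact ⟨(i:ℤ)-j, by ring⟩

lemma height_iff {p n : ℕ} (hp : 0 < p) (hn : 0 < n) (t : ℝ) (y : Fin p → Fin (2*n+1) → ℤ) :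
    ((melonHeight y : ℝ) + 1)/Real.sqrt n ≤ t ↔ ∀ i s, y i s < ⌊t * Real.sqrt n⌋ := by
  have hs : 0 < Real.sqrt n := Real.sqrt_pos.mpr (by exact_mod_cast hn)
  have hfin : {v | ∃ i t, y i t = v}.Finite := by
    have : {v | ∃ i t, y i t = v} = Set.range (fun q : Fin p × Fin (2*n+1) => y q.1 q.2) := by
      ext v; simp
    rw [this]; exact Set.finite_range _
  have hne : {v | ∃ i t, y i t = v}.Nonempty := ⟨_, ⟨0, hp⟩, 0, rfl⟩
  rw [div_le_iff₀ hs]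
  have h1 : ((melonHeight y : ℝ) + 1) ≤ t * Real.sqrt n ↔ melonHeight y + 1 ≤ ⌊t * Real.sqrt n⌋ := by
    rw [Int.le_floor]; push_cast; rfl
  rw [h1]
  constructor
  · intro h i s
    have : y i s ≤ melonHeight y := le_csSup hfin.bddAbove ⟨i, s, rfl⟩
    omega
  · intro h
    have : melonHeight y ∈ {v | ∃ i t, y i t = v} := hne.csSup_mem hfin
    obtain ⟨i, s, hi⟩ := this
    have := h i s
    omega

noncomputable def hu (j : ℕ) : ℝ := (-1)^j / j.factorial
noncomputable def hv (X : ℝ) (r : ℤ) : ℝ := if 0 ≤ r then X^r.toNat / r.toNat.factorial else 0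

lemma hu_rec (j : ℕ) : ((j:ℝ)+1) * hu (j+1) = - hu j := by
  unfold hu
  rw [Nat.factorial_succ, pow_succ]
  have : (j.factorial : ℝ) ≠ 0 := by positivity
  have : (j:ℝ)+1 ≠ 0 := by positivity
  push_cast
  field_simp

lemma hv_rec (X : ℝ) (r : ℤ) : (r:ℝ) * hv X r = X * hv X (r-1) := by
  unfold hv
  rcases lt_trichotomy r 0 with h | h | h
  · rw [if_neg (by omega), if_neg (by omega)]; simp
  · subst h; simp
  · obtain ⟨k, rfl⟩ : ∃ k : ℕ, r = (k:ℤ)+1 := ⟨(r-1).toNat, by omega⟩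
    rw [if_pos (by omega), if_pos (by omega)]
    rw [show ((k:ℤ)+1).toNat = k+1 by omega, show ((k:ℤ)+1-1).toNat = k by omega]
    rw [Nat.factorial_succ, pow_succ]
    have : (k.factorial : ℝ) ≠ 0 := by positivity
    have : (k:ℝ)+1 ≠ 0 := by positivity
    push_cast
    field_simp

noncomputable def hs (X : ℝ) (k : ℕ) : ℝ := ∑ j ∈ Finset.range (k+1), hu j * hv X ((k:ℤ)-2*j)

lemma hermiteH_eq (k : ℕ) (z : ℝ) : hermiteH k z = (k.factorial:ℝ) * hs (2*z) k := by
  unfold hermiteH hs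
  congr 1
  rw [← Finset.sum_range_reflect]
  apply Finset.sum_congr rfl
  intro j hj
  have hj : j < k+1 := Finset.mem_range.mp hj
  rw [show k + 1 - 1 - j = k - j by omega]
  unfold hu hv
  by_cases h : k ≤ 2 * (k-j)
  · rw [if_pos h, if_pos (by omega)]
    rw [show k - (k-j) = j by omega, show ((k:ℤ)-2*j).toNat = 2*(k-j)-k by omega]
  · rw [if_neg h, if_neg (by omega)]; simp

lemma hs_rec (X : ℝ) (k : ℕ) : ((k:ℝ)+2) * hs X (k+2) = X * hs X (k+1) - 2 * hs X k := by
  have h1 : ((k:ℝ)+2) * hs X (k+2) =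
      ∑ j ∈ Finset.range (k+3), hu j * (X * hv X ((k:ℤ)+1-2*j)) +
      ∑ j ∈ Finset.range (k+3), 2 * (j * hu j) * hv X ((k:ℤ)+2-2*j) := by
    unfold hs
    rw [← Finset.sum_add_distrib, Finset.mul_sum]
    apply Finset.sum_congr rfl
    intro j _
    have := hv_rec X ((k:ℤ)+2-2*j)
    rw [show (k:ℤ)+2-2*j-1 = (k:ℤ)+1-2*j by ring] at this
    rw [← this]
    push_cast
    ring
  have h2 : ∑ j ∈ Finset.range (k+3), hu j * (X * hv X ((k:ℤ)+1-2*j)) = X * hs X (k+1) := by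
    rw [Finset.sum_range_succ]
    have : hv X ((k:ℤ)+1-2*((k+2:ℕ):ℤ)) = 0 := by unfold hv; rw [if_neg (by push_cast; omega)]
    rw [this]
    unfold hs
    rw [Finset.mul_sum]
    simp only [mul_zero, add_zero]
    apply Finset.sum_congr rfl
    intro j _
    push_cast
    ring
  have h3 : ∑ j ∈ Finset.range (k+3), 2 * (j * hu j) * hv X ((k:ℤ)+2-2*j) = - (2 * hs X k) := by
    rw [Finset.sum_range_succ', Finset.sum_range_succ]
    have : hv X ((k:ℤ)+2-2*((k+1+1:ℕ):ℤ)) = 0 := by unfold hv; rw [if_neg (by push_cast; omega)]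
    rw [this]
    unfold hs
    rw [Finset.mul_sum, ← Finset.sum_neg_distrib]
    simp only [mul_zero, add_zero, Nat.cast_zero, zero_mul]
    apply Finset.sum_congr rfl
    intro j _
    have := hu_rec j
    push_cast
    rw [this, show (k:ℤ)+2-2*(j+1) = (k:ℤ)-2*j by ring]
    ring
  rw [h1, h2, h3]; ring

lemma hermiteH_zero (z : ℝ) : hermiteH 0 z = 1 := by simp [hermiteH]
lemma hermiteH_one (z : ℝ) : hermiteH 1 z = 2*z := by
  simp [hermiteH, Finset.sum_range_succ]

lemma hermiteH_rec (k : ℕ) (z : ℝ) :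
    hermiteH (k+2) z = 2*z * hermiteH (k+1) z - 2*((k:ℝ)+1) * hermiteH k z := by
  have h := hs_rec (2*z) k
  rw [hermiteH_eq, hermiteH_eq, hermiteH_eq, Nat.factorial_succ, Nat.factorial_succ]
  push_cast
  linear_combination ((k:ℝ)+1) * (k.factorial:ℝ) * h

/-- Stieltjes tableau. -/
noncomputable def sL : ℕ → ℕ → ℝ
  | 0, 0 => 1
  | 0, _+1 => 0
  | i+1, 0 => -2 * sL i 1
  | i+1, k+1 => sL i k - 2 * ((k:ℝ)+2) * sL i (k+2)

lemma sL_zero_of_lt (i : ℕ) : ∀ k, i < k → sL i k = 0 := by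
  induction i with
  | zero => intro k hk; cases k with
    | zero => omega
    | succ k => simp [sL]
  | succ i ih => intro k hk; cases k with
    | zero => omega
    | succ k => rw [sL, ih _ (by omega), ih _ (by omega)]; simp

lemma sL_diag (i : ℕ) : sL i i = 1 := by
  induction i with
  | zero => simp [sL]
  | succ i ih => rw [sL, ih, sL_zero_of_lt _ _ (by omega)]; simp

lemma sL_deriv (i : ℕ) : ∀ k : ℕ, ((k:ℝ)+1) * sL (i+1) (k+1) = ((i:ℝ)+1) * sL i k := by
  induction i with
  | zero => intro k; cases k <;> simp [sL]
  | succ i ih =>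
    intro k
    rw [sL]
    have h1 := ih (k+1)
    cases k with
    | zero =>
      have h2 : sL (i+1) 0 = -2 * sL i 1 := by rw [sL]
      push_cast at *
      linear_combination (-2) * h1 + ((i:ℝ)+1) * (-1) * h2
    | succ k =>
      have h2 : sL (i+1) (k+1) = sL i k - 2 * ((k:ℝ)+2) * sL i (k+2) := by rw [sL]
      have h3 := ih k
      push_cast at *
      linear_combination (-2) * ((k:ℝ)+2) * h1 - ((i:ℝ)+1) * h2 + h3

lemma sL_herm (i : ℕ) : sL i 0 = hermiteH i 0 ∧ sL (i+1) 0 = hermiteH (i+1) 0 := by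
  induction i with
  | zero => constructor <;> simp [sL, hermiteH_zero, hermiteH_one]
  | succ i ih =>
    refine ⟨ih.2, ?_⟩
    rw [sL, hermiteH_rec, ← ih.1]
    have := sL_deriv i 0
    simp only [Nat.cast_zero, zero_add, one_mul] at this
    rw [this]; ring

noncomputable def sD (k : ℕ) : ℝ := (-2)^k * k.factorial

lemma sD_succ (k : ℕ) : sD (k+1) = -2 * ((k:ℝ)+1) * sD k := by
  unfold sD; rw [Nat.factorial_succ, pow_succ]; push_cast; ring

lemma sA_shift (i j N : ℕ) (hN : i + j + 2 < N) :
    ∑ k ∈ Finset.range N, sL (i+1) k * sD k * sL j k =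
    ∑ k ∈ Finset.range N, sL i k * sD k * sL (j+1) k := by
  obtain ⟨M, rfl⟩ : ∃ M, N = M+1 := ⟨N-1, by omega⟩
  have aux : ∀ a b : ℕ, a < M → b < M → ∑ k ∈ Finset.range (M+1), sL (a+1) k * sD k * sL b k =
      ∑ k ∈ Finset.range M, sD (k+1) * (sL a k * sL b (k+1) + sL a (k+1) * sL b k) := by
    intro a b ha hb
    have e1 : ∑ k ∈ Finset.range (M+1), sL (a+1) k * sD k * sL b k =
        ∑ k ∈ Finset.range M, sD (k+1) * (sL a k * sL b (k+1))
        + ∑ k ∈ Finset.range (M+1), sD (k+1) * (sL a (k+1) * sL b k) := by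
      rw [Finset.sum_range_succ', Finset.sum_range_succ' _ M, ← add_assoc,
        ← Finset.sum_add_distrib]
      congr 1
      · apply Finset.sum_congr rfl
        intro k _
        rw [sL, sD_succ (k+1)]
        push_cast
        ring
      · rw [sL, sD_succ]; push_cast; ring
    rw [e1, Finset.sum_range_succ _ M, sL_zero_of_lt b M hb, ← add_assoc,
      ← Finset.sum_add_distrib]
    simp only [mul_zero, add_zero]
    apply Finset.sum_congr rfl
    intro k _
    ring
  have e2 : ∑ k ∈ Finset.range (M+1), sL i k * sD k * sL (j+1) k =
      ∑ k ∈ Finset.range (M+1), sL (j+1) k * sD k * sL i k := by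
    apply Finset.sum_congr rfl
    intro k _
    ring
  rw [e2, aux i j (by omega) (by omega), aux j i (by omega) (by omega)]
  apply Finset.sum_congr rfl
  intro k _
  ring

lemma sA_eq (j : ℕ) : ∀ i N, i + j + 2 < N →
    ∑ k ∈ Finset.range N, sL i k * sD k * sL j k = hermiteH (i+j) 0 := by
  induction j with
  | zero =>
    intro i N hN
    rw [Finset.sum_eq_single 0]
    · simp [sL, sD, (sL_herm i).1]
    · intro k _ hk
      rw [sL_zero_of_lt 0 k (by omega)]; simp
    · intro h; exact absurd (Finset.mem_range.mpr (by omega)) h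
  | succ j ih =>
    intro i N hN
    rw [← sA_shift i j N (by omega), ih (i+1) N (by omega)]
    congr 1; ring

lemma sA_fin (p : ℕ) (i j : Fin p) :
    ∑ k : Fin p, sL i k * sD k * sL j k = hermiteH ((i:ℕ)+j) 0 := by
  rw [← sA_eq (j:ℕ) i (i+j+3+p) (by omega),
    Fin.sum_univ_eq_sum_range (fun k => sL i k * sD k * sL j k) p]
  symm
  rw [← Finset.sum_subset (Finset.range_subset_range.mpr (show p ≤ i+j+3+p by omega))]
  intro k _ hk
  rw [sL_zero_of_lt i k]
  · simp
  · have := i.2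
    simp at hk; omega

lemma det_herm (p : ℕ) : Matrix.det (Matrix.of fun i j : Fin p =>
      (-1:ℝ)^(i : ℕ) * hermiteH ((i : ℕ)+(j : ℕ)) 0) =
      (2:ℝ)^(p.choose 2) * ∏ j ∈ Finset.range p, (j.factorial : ℝ) := by
  set S : Matrix (Fin p) (Fin p) ℝ := Matrix.of fun i k => sL i k with hS
  have h1 : (Matrix.of fun i j : Fin p => (-1:ℝ)^(i : ℕ) * hermiteH ((i : ℕ)+(j : ℕ)) 0) =
      Matrix.diagonal (fun i : Fin p => (-1:ℝ)^(i:ℕ)) *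
        (S * Matrix.diagonal (fun k : Fin p => sD k) * S.transpose) := by
    ext i j
    rw [Matrix.diagonal_mul, Matrix.mul_apply, Matrix.of_apply, ← sA_fin]
    congr 1
    apply Finset.sum_congr rfl
    intro k _
    rw [Matrix.mul_diagonal]
    simp [hS]
  have hd : S.det = 1 := by
    rw [Matrix.det_of_isLowerTriangular]
    · simp [hS, sL_diag]
    · intro i j hij
      exact sL_zero_of_lt _ _ hij
  rw [h1, Matrix.det_mul, Matrix.det_mul, Matrix.det_mul, Matrix.det_transpose, hd,
    Matrix.det_diagonal, Matrix.det_diagonal, one_mul, mul_one, ← Finset.prod_mul_distrib]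
  have h2 : ∀ i : Fin p, (-1:ℝ)^(i:ℕ) * sD i = 2^(i:ℕ) * ((i:ℕ).factorial:ℝ) := by
    intro i
    unfold sD
    rw [← mul_assoc, ← mul_pow]; norm_num
  rw [Finset.prod_congr rfl (fun i _ => h2 i),
    Fin.prod_univ_eq_prod_range (fun i => (2:ℝ)^i * (i.factorial:ℝ)) p, Finset.prod_mul_distrib,
    Finset.prod_pow_eq_pow_sum, Finset.sum_range_id, Nat.choose_two_right]

open Asymptotics in
/-- `u n = L + O(n^{-1/2})`. -/
def App (u : ℕ → ℝ) (L : ℝ) : Prop :=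
  (fun n => u n - L) =O[atTop] (fun n : ℕ => (Real.sqrt n)⁻¹)

lemma rt_tendsto : Tendsto (fun n : ℕ => (Real.sqrt n)⁻¹) atTop (nhds 0) :=
  tendsto_inv_atTop_zero.comp (Real.tendsto_sqrt_atTop.comp tendsto_natCast_atTop_atTop)

lemma App.tendsto {u : ℕ → ℝ} {L : ℝ} (h : App u L) : Tendsto u atTop (nhds L) := by
  have := h.trans_tendsto rt_tendsto
  have h2 := this.add_const L
  simpa using h2

lemma App.const (L : ℝ) : App (fun _ => L) L := by
  unfold App; simp only [sub_self]; exact Asymptotics.isBigO_zero _ _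

lemma App.rt : App (fun n : ℕ => (Real.sqrt n)⁻¹) 0 := by
  unfold App; simp only [sub_zero]; exact Asymptotics.isBigO_refl _ _

lemma App.add {u v : ℕ → ℝ} {L M : ℝ} (h : App u L) (h' : App v M) :
    App (fun n => u n + v n) (L + M) := by
  unfold App at *
  refine (Asymptotics.IsBigO.add h h').congr_left (fun n => ?_)
  ring

lemma App.mul {u v : ℕ → ℝ} {L M : ℝ} (h : App u L) (h' : App v M) :
    App (fun n => u n * v n) (L * M) := by
  have hv : v =O[atTop] (fun _ : ℕ => (1:ℝ)) := h'.tendsto.isBigO_one ℝ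
  unfold App at *
  have h1 := (Asymptotics.IsBigO.mul h hv)
  have h2 := h'.const_mul_left L
  simp only [mul_one] at h1
  refine (h1.add h2).congr_left (fun n => ?_)
  ring

lemma App.cmul {u : ℕ → ℝ} {L : ℝ} (c : ℝ) (h : App u L) : App (fun n => c * u n) (c * L) :=
  (App.const c).mul h

lemma App.neg {u : ℕ → ℝ} {L : ℝ} (h : App u L) : App (fun n => - u n) (-L) := by
  simpa using h.cmul (-1)

lemma App.sub {u v : ℕ → ℝ} {L M : ℝ} (h : App u L) (h' : App v M) :
    App (fun n => u n - v n) (L - M) := by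
  simpa [sub_eq_add_neg] using h.add h'.neg

lemma App.comp {u : ℕ → ℝ} {L : ℝ} (h : App u L) {g : ℝ → ℝ} (hg : DifferentiableAt ℝ g L) :
    App (fun n => g (u n)) (g L) :=
  ((hg.hasDerivAt.isBigO_sub).comp_tendsto h.tendsto).trans h

lemma App.inv {u : ℕ → ℝ} {L : ℝ} (h : App u L) (hL : L ≠ 0) : App (fun n => (u n)⁻¹) L⁻¹ :=
  h.comp (differentiableAt_inv hL)

lemma App.abs {u : ℕ → ℝ} {L : ℝ} (h : App u L) : App (fun n => |u n|) |L| := by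
  unfold App at *
  refine Asymptotics.IsBigO.trans (Asymptotics.IsBigO.of_bound 1 (Eventually.of_forall ?_)) h
  intro n
  simp only [Real.norm_eq_abs, one_mul]
  exact abs_abs_sub_abs_le _ _

lemma App.congr {u v : ℕ → ℝ} {L : ℝ} (h : App u L) (huv : ∀ᶠ n in atTop, u n = v n) :
    App v L := by
  unfold App at *
  refine h.congr' ?_ (Eventually.of_forall fun _ => rfl)
  filter_upwards [huv] with n hn
  rw [hn]

lemma App.sum {ι : Type*} (s : Finset ι) {u : ι → ℕ → ℝ} {L : ι → ℝ}
    (h : ∀ i ∈ s, App (u i) (L i)) : App (fun n => ∑ i ∈ s, u i n) (∑ i ∈ s, L i) := by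
  classical
  induction s using Finset.induction_on with
  | empty => simpa using App.const 0
  | insert a s ha ih =>
    simp only [Finset.sum_insert ha]
    exact (h a (by simp)).add (ih fun i hi => h i (by simp [hi]))

lemma App.prod {ι : Type*} (s : Finset ι) {u : ι → ℕ → ℝ} {L : ι → ℝ}
    (h : ∀ i ∈ s, App (u i) (L i)) : App (fun n => ∏ i ∈ s, u i n) (∏ i ∈ s, L i) := by
  classical
  induction s using Finset.induction_on with
  | empty => simpa using App.const 1
  | insert a s ha ih =>
    simp only [Finset.prod_insert ha]
    exact (h a (by simp)).mul (ih fun i hi => h i (by simp [hi]))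

lemma App.det {p : ℕ} {A : ℕ → Matrix (Fin p) (Fin p) ℝ} {B : Matrix (Fin p) (Fin p) ℝ}
    (h : ∀ i j, App (fun n => A n i j) (B i j)) : App (fun n => (A n).det) B.det := by
  simp only [Matrix.det_apply']
  apply App.sum
  intro σ _
  apply App.cmul
  apply App.prod
  intro i _
  exact h _ _

/-- central binomial coefficients -/
noncomputable def ff (n : ℕ) (x : ℤ) : ℝ := wc (2*n) (2*x)

lemma ff_even (n : ℕ) (x : ℤ) : ff n (-x) = ff n x := by
  unfold ff; rw [← wc_even]; congr 1; ring

lemma ff_pos (n : ℕ) : 0 < ff n 0 := by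
  have := wc_pos n
  simpa [ff] using this

lemma ff_rec (n : ℕ) (x : ℤ) : ((n:ℝ)+x+1) * ff n (x+1) = ((n:ℝ)-x) * ff n x := by
  have := wc_rec (2*n) (2*x)
  unfold ff
  rw [show 2*(x+1) = 2*x+2 by ring]
  push_cast at this
  linear_combination this/2

lemma ff_prod (n k : ℕ) : ff n k = ff n 0 * ∏ j ∈ Finset.range k, (((n:ℝ)-j)/((n:ℝ)+j+1)) := by
  induction k with
  | zero => simp
  | succ k ih =>
    rw [Finset.prod_range_succ, ← mul_assoc, ← ih]
    have := ff_rec n k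
    have h : (n:ℝ)+k+1 ≠ 0 := by positivity
    push_cast at *
    field_simp
    linear_combination this

lemma prod_diff (a b : ℕ → ℝ) (c : ℝ) (k : ℕ) (ha : ∀ j < k, 0 ≤ a j ∧ a j ≤ 1)
    (hb : ∀ j < k, 0 ≤ b j ∧ b j ≤ 1) (hab : ∀ j < k, |a j - b j| ≤ c) :
    |∏ j ∈ Finset.range k, a j - ∏ j ∈ Finset.range k, b j| ≤ k * c := by
  induction k with
  | zero => simp
  | succ k ih =>
    have ih := ih (fun j hj => ha j (by omega)) (fun j hj => hb j (by omega))
      (fun j hj => hab j (by omega))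
    rw [Finset.prod_range_succ, Finset.prod_range_succ]
    have h1 : 0 ≤ ∏ j ∈ Finset.range k, a j := Finset.prod_nonneg (fun j hj =>
      (ha j (by have := Finset.mem_range.mp hj; omega)).1)
    have h2 : ∏ j ∈ Finset.range k, a j ≤ 1 := Finset.prod_le_one (fun j hj =>
      (ha j (by have := Finset.mem_range.mp hj; omega)).1) (fun j hj =>
      (ha j (by have := Finset.mem_range.mp hj; omega)).2)
    set A := ∏ j ∈ Finset.range k, a j
    set B := ∏ j ∈ Finset.range k, b j
    have e : A * a k - B * b k = A * (a k - b k) + (A - B) * b k := by ring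
    rw [e]
    refine (abs_add_le _ _).trans ?_
    rw [abs_mul, abs_mul, abs_of_nonneg h1, abs_of_nonneg (hb k (by omega)).1]
    have h3 := hab k (by omega)
    have h4 : A * |a k - b k| ≤ |a k - b k| := mul_le_of_le_one_left (abs_nonneg _) h2
    have h5 : |A - B| * b k ≤ |A - B| := mul_le_of_le_one_right (abs_nonneg _) (hb k (by omega)).2
    push_cast
    linarith

lemma ff_exp (n k : ℕ) (hn : 0 < n) (hk : k ≤ n) :
    |ff n k / ff n 0 - Real.exp (-((k:ℝ)^2/n))| ≤ k * (2*(k:ℝ)/n)^2 := by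
  have hn' : (0:ℝ) < n := by exact_mod_cast hn
  have h1 : ff n k / ff n 0 = ∏ j ∈ Finset.range k, (((n:ℝ)-j)/((n:ℝ)+j+1)) := by
    rw [ff_prod]; field_simp [(ff_pos n).ne']
  have h2 : Real.exp (-((k:ℝ)^2/n)) = ∏ j ∈ Finset.range k, Real.exp (-((2*(j:ℝ)+1)/n)) := by
    rw [← Real.exp_sum, Finset.sum_neg_distrib, ← Finset.sum_div]
    congr 3
    clear hk h1
    induction k with
    | zero => simp
    | succ k ih => rw [Finset.sum_range_succ, ← ih]; push_cast; ring
  rw [h1, h2]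
  apply prod_diff
  · intro j hj
    have : (j:ℝ) ≤ n := by exact_mod_cast (by omega : j ≤ n)
    constructor
    · apply div_nonneg <;> linarith [(Nat.cast_nonneg j : (0:ℝ) ≤ j)]
    · rw [div_le_one (by positivity)]; linarith [(Nat.cast_nonneg j : (0:ℝ) ≤ j)]
  · intro j hj
    refine ⟨(Real.exp_pos _).le, Real.exp_le_one_iff.mpr ?_⟩
    have : 0 ≤ (2*(j:ℝ)+1)/n := by positivity
    linarith
  · intro j hj
    set u : ℝ := (2*(j:ℝ)+1)/n with hu
    have hu0 : 0 ≤ u := by positivity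
    have huk : u ≤ 2*(k:ℝ)/n := by
      rw [hu]
      gcongr
      have : (j:ℝ) + 1 ≤ k := by exact_mod_cast hj
      linarith
    have hjn : (0:ℝ) < (n:ℝ)+j+1 := by positivity
    have a1 : 1 - u ≤ ((n:ℝ)-j)/((n:ℝ)+j+1) := by
      rw [le_div_iff₀ hjn, hu]
      have : 0 ≤ (2*(j:ℝ)+1)*(j+1)/n := by positivity
      have e : (1 - (2*(j:ℝ)+1)/n) * ((n:ℝ)+j+1) = (n:ℝ) - j - (2*(j:ℝ)+1)*(j+1)/n := by
        field_simp; ring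
      linarith
    have a2 : ((n:ℝ)-j)/((n:ℝ)+j+1) ≤ 1 - u + u^2 := by
      rw [div_le_iff₀ hjn, hu]
      have e : (1 - (2*(j:ℝ)+1)/n + ((2*(j:ℝ)+1)/n)^2) * ((n:ℝ)+j+1) =
        (n:ℝ) - j + ((2*(j:ℝ)+1)*j/n + (2*(j:ℝ)+1)^2*(j+1)/n^2) := by
        field_simp; ring
      have : 0 ≤ ((2*(j:ℝ)+1)*j/n + (2*(j:ℝ)+1)^2*(j+1)/n^2) := by positivity
      linarith
    have b1 : 1 - u ≤ Real.exp (-u) := by linarith [Real.add_one_le_exp (-u)]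
    have b2 : Real.exp (-u) ≤ 1 - u + u^2 := by
      rw [Real.exp_neg, inv_le_comm₀ (Real.exp_pos _) (by nlinarith [sq_nonneg (u-1)])]
      refine le_trans ?_ (Real.add_one_le_exp u)
      rw [inv_le_iff_one_le_mul₀ (by nlinarith [sq_nonneg (u-1)])]
      have : 0 ≤ u^3 := by positivity
      nlinarith
    have h3 : u^2 ≤ (2*(k:ℝ)/n)^2 := by gcongr
    rw [abs_le]
    constructor <;> linarith

lemma ff_app (x : ℕ → ℤ) (s : ℝ) (hx : App (fun n => (x n : ℝ) * (Real.sqrt n)⁻¹) s) :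
    App (fun n => ff n (x n) / ff n 0) (Real.exp (-s^2)) := by
  set k : ℕ → ℕ := fun n => (x n).natAbs with hk
  have hkx : ∀ n, ff n (x n) = ff n (k n) := by
    intro n
    rcases Int.natAbs_eq (x n) with h | h
    · rw [← h]
    · conv_lhs => rw [h]
      rw [ff_even]
  have hka : App (fun n => (k n : ℝ) * (Real.sqrt n)⁻¹) |s| := by
    refine hx.abs.congr (Eventually.of_forall fun n => ?_)
    rw [abs_mul, abs_of_nonneg (by positivity : (0:ℝ) ≤ (Real.sqrt n)⁻¹)]
    congr 1
    simp [hk, Nat.cast_natAbs]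
  have h1 : App (fun n => Real.exp (-((k n : ℝ) * (Real.sqrt n)⁻¹)^2)) (Real.exp (-s^2)) := by
    have := hka.comp (g := fun y => Real.exp (-y^2)) (by fun_prop)
    simpa using this
  have hkn : ∀ᶠ n in atTop, k n ≤ n := by
    have h2 : Tendsto (fun n : ℕ => (k n : ℝ) * (Real.sqrt n)⁻¹ * (Real.sqrt n)⁻¹) atTop (nhds (|s| * 0)) :=
      hka.tendsto.mul rt_tendsto
    rw [mul_zero] at h2
    filter_upwards [h2.eventually (gt_mem_nhds one_pos), eventually_gt_atTop 0] with n hn hn0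
    have hn' : (0:ℝ) < n := by exact_mod_cast hn0
    rw [mul_assoc, ← mul_inv, Real.mul_self_sqrt hn'.le, ← div_eq_mul_inv, div_lt_one hn'] at hn
    exact_mod_cast hn.le
  have h3 : App (fun n => ff n (x n) / ff n 0 - Real.exp (-((k n : ℝ) * (Real.sqrt n)⁻¹)^2)) 0 := by
    unfold App
    have hb : (fun n : ℕ => 4 * ((k n : ℝ) * (Real.sqrt n)⁻¹)^3 * (Real.sqrt n)⁻¹) =O[atTop]
        (fun n : ℕ => (Real.sqrt n)⁻¹) := by
      have h4 : (fun n : ℕ => 4 * ((k n : ℝ) * (Real.sqrt n)⁻¹)^3) =O[atTop] (fun _ => (1:ℝ)) :=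
        ((hka.tendsto.pow 3).const_mul 4).isBigO_one ℝ
      have := h4.mul (Asymptotics.isBigO_refl (fun n : ℕ => (Real.sqrt n)⁻¹) atTop)
      simpa using this
    refine Asymptotics.IsBigO.trans (Asymptotics.IsBigO.of_bound 1 ?_) hb
    filter_upwards [hkn, eventually_gt_atTop 0] with n hn hn0
    have hn' : (0:ℝ) < n := by exact_mod_cast hn0
    have := ff_exp n (k n) hn0 hn
    have hs : 0 < Real.sqrt n := Real.sqrt_pos.mpr hn'
    have hss : Real.sqrt n ^ 2 = n := Real.sq_sqrt hn'.le
    rw [Real.norm_eq_abs, Real.norm_eq_abs, sub_zero, one_mul, hkx]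
    have e1 : ((k n : ℝ) * (Real.sqrt n)⁻¹)^2 = (k n : ℝ)^2 / n := by
      rw [mul_pow, inv_pow, hss]; rfl
    rw [e1]
    refine this.trans (le_trans (le_of_eq ?_) (le_abs_self _))
    have : ((n:ℝ))^2 = Real.sqrt n ^ 4 := by rw [← hss]; ring_nf; rw [Real.sqrt_sq hs.le]
    rw [div_pow, this]
    field_simp
    ring
  have := h3.add h1
  rw [zero_add] at this
  refine this.congr (Eventually.of_forall fun n => ?_)
  ring

open fwdDiff in
lemma dd_succ (f : ℤ → ℝ) (m : ℕ) (x : ℤ) :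
    (fwdDiff (1:ℤ))^[m+1] f x = (fwdDiff (1:ℤ))^[m] f (x+1) - (fwdDiff (1:ℤ))^[m] f x := by
  rw [Function.iterate_succ_apply']; rfl

lemma dd_rec (n m : ℕ) : ∀ x : ℤ,
    ((n:ℝ)+x+m+2) * (fwdDiff (1:ℤ))^[m+2] (ff n) x + (2*x+3*m+4) * (fwdDiff (1:ℤ))^[m+1] (ff n) x
      + 2*((m:ℝ)+1) * (fwdDiff (1:ℤ))^[m] (ff n) x = 0 := by
  induction m with
  | zero =>
    intro x
    have h1 := ff_rec n x
    have h2 := ff_rec n (x+1)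
    simp only [dd_succ, Function.iterate_zero, id]
    push_cast at *
    linear_combination h2 - h1
  | succ m ih =>
    intro x
    have h1 := ih x
    have h2 := ih (x+1)
    have e1 := dd_succ (ff n) (m+2) x
    have e2 := dd_succ (ff n) (m+1) x
    have e3 := dd_succ (ff n) m x
    rw [show m+1+2 = m+2+1 by ring, e1]
    rw [show m+1+1 = m+2 by ring] at *
    push_cast at *
    linear_combination h2 - h1 + (2*(x:ℝ)+3*m+6) * e2  + 2*((m:ℝ)+1) * e3

/-- scaled differences -/
noncomputable def FF (x : ℕ → ℤ) (m n : ℕ) : ℝ :=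
  (fwdDiff (1:ℤ))^[m] (ff n) (x n) * Real.sqrt n ^ m / ff n 0

lemma FF_den (x : ℕ → ℤ) (s c : ℝ) (hx : App (fun n => (x n : ℝ) * (Real.sqrt n)⁻¹) s) :
    App (fun n => 1 + (x n : ℝ) * (Real.sqrt n)⁻¹ * (Real.sqrt n)⁻¹ +
      c * ((Real.sqrt n)⁻¹ * (Real.sqrt n)⁻¹)) 1 := by
  have := ((App.const 1).add (hx.mul App.rt)).add ((App.rt.mul App.rt).cmul c)
  simpa using this

lemma FF_app (x : ℕ → ℤ) (s : ℝ) (hx : App (fun n => (x n : ℝ) * (Real.sqrt n)⁻¹) s) (m : ℕ) :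
    App (FF x m) ((-1)^m * hermiteH m s * Real.exp (-s^2)) ∧
    App (FF x (m+1)) ((-1)^(m+1) * hermiteH (m+1) s * Real.exp (-s^2)) := by
  induction m with
  | zero =>
    have h0 := ff_app x s hx
    have h0' : App (FF x 0) (Real.exp (-s^2)) := by
      refine h0.congr (Eventually.of_forall fun n => ?_)
      simp [FF]
    refine ⟨by simpa [hermiteH_zero] using h0', ?_⟩
    have hd := FF_den x s 1 hx
    have h2 := (((hx.cmul 2).add App.rt).mul h0').neg.mul (hd.inv one_ne_zero)
    have e : -((2 * s + 0) * Real.exp (-s ^ 2)) * (1:ℝ)⁻¹ =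
      ((-1)^(0+1) * hermiteH (0+1) s * Real.exp (-s^2)) := by
      rw [zero_add, hermiteH_one]; ring
    rw [e] at h2
    refine h2.congr ?_
    filter_upwards [hd.tendsto.eventually_ne one_ne_zero, eventually_gt_atTop 0] with n hn hn0
    have hn' : (0:ℝ) < n := by exact_mod_cast hn0
    have hs : 0 < Real.sqrt n := Real.sqrt_pos.mpr hn'
    have hss : Real.sqrt n ^ 2 = n := Real.sq_sqrt hn'.le
    rw [mul_inv_eq_iff_eq_mul₀ hn]
    have h1 := ff_rec n (x n)
    have hf := (ff_pos n).ne'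
    simp only [FF, dd_succ, Function.iterate_zero, id, zero_add, pow_one, pow_zero]
    rw [← hss] at h1
    set r := Real.sqrt n
    field_simp
    linear_combination - h1
  | succ m ih =>
    refine ⟨ih.2, ?_⟩
    have hd := FF_den x s ((m:ℝ)+2) hx
    have h2 := ((((hx.cmul 2).add (App.rt.cmul (3*(m:ℝ)+4))).mul ih.2).add
      (ih.1.cmul (2*((m:ℝ)+1)))).neg.mul (hd.inv one_ne_zero)
    have e : -((2 * s + (3*(m:ℝ)+4) * 0) * ((-1)^(m+1) * hermiteH (m+1) s * Real.exp (-s^2)) +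
        2*((m:ℝ)+1) * ((-1)^m * hermiteH m s * Real.exp (-s^2))) * (1:ℝ)⁻¹ =
      ((-1)^(m+1+1) * hermiteH (m+1+1) s * Real.exp (-s^2)) := by
      rw [hermiteH_rec]; ring
    rw [e] at h2
    refine h2.congr ?_
    filter_upwards [hd.tendsto.eventually_ne one_ne_zero, eventually_gt_atTop 0] with n hn hn0
    have hn' : (0:ℝ) < n := by exact_mod_cast hn0
    have hs : 0 < Real.sqrt n := Real.sqrt_pos.mpr hn'
    have hss : Real.sqrt n ^ 2 = n := Real.sq_sqrt hn'.le
    rw [mul_inv_eq_iff_eq_mul₀ hn]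
    have h1 := dd_rec n m (x n)
    have hf := (ff_pos n).ne'
    simp only [FF]
    rw [← hss] at h1
    rw [show m + 1 + 1 = m + 2 by ring]
    set r := Real.sqrt n
    set A2 := (fwdDiff (1:ℤ))^[m+2] (ff n) (x n)
    set A1 := (fwdDiff (1:ℤ))^[m+1] (ff n) (x n)
    set A0 := (fwdDiff (1:ℤ))^[m] (ff n) (x n)
    have hr : r^m ≠ 0 := by positivity
    rw [pow_succ, pow_add r m 2]
    field_simp
    linear_combination - h1

/-- difference matrix -/
def PP (p : ℕ) : Matrix (Fin p) (Fin p) ℝ :=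
  Matrix.of fun k i => (-1)^((k:ℕ)-(i:ℕ)) * (((k:ℕ).choose (i:ℕ) : ℕ) : ℝ)

lemma PP_det (p : ℕ) : (PP p).det = 1 := by
  rw [Matrix.det_of_isLowerTriangular]
  · simp [PP]
  · intro i j hij
    have h : (i:ℕ) < j := hij
    simp [PP, Nat.choose_eq_zero_of_lt h]

lemma PP_sum (p : ℕ) (k : Fin p) (g : ℤ → ℝ) (a x : ℤ) :
    ∑ i : Fin p, PP p k i * g (x + (i:ℕ) • a) = (fwdDiff a)^[(k:ℕ)] g x := by
  rw [fwdDiff_iter_eq_sum_shift]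
  have h := Fin.sum_univ_eq_sum_range (fun i => ((-1:ℝ)^((k:ℕ)-i) * (((k:ℕ).choose i : ℕ) : ℝ))
    * g (x + i • a)) p
  refine (h.trans ?_)
  symm
  have hk : (k:ℕ) + 1 ≤ p := k.2
  rw [← Finset.sum_subset (Finset.range_subset_range.mpr hk)]
  · apply Finset.sum_congr rfl
    intro i _
    simp
  · intro i _ hi
    have : (k:ℕ) < i := by simp at hi; omega
    simp [Nat.choose_eq_zero_of_lt this]

lemma dd_shift (g : ℤ → ℝ) (c : ℝ) (a : ℤ) (k : ℕ) : ∀ x,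
    (fwdDiff (1:ℤ))^[k] (fun x => c * g (x + a)) x = c * (fwdDiff (1:ℤ))^[k] g (x+a) := by
  induction k with
  | zero => intro x; rfl
  | succ k ih =>
    intro x
    rw [dd_succ, dd_succ, ih, ih, show x + 1 + a = x + a + 1 by ring]
    ring

lemma dd_neg (g : ℤ → ℝ) (l : ℕ) : ∀ x,
    (fwdDiff (-1:ℤ))^[l] g x = (-1)^l * (fwdDiff (1:ℤ))^[l] g (x + -(l:ℤ)) := by
  induction l with
  | zero => intro x; simp
  | succ l ih =>
    intro x
    rw [Function.iterate_succ_apply', dd_succ]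
    show (fwdDiff (-1:ℤ))^[l] g (x + -1) - (fwdDiff (-1:ℤ))^[l] g x = _
    rw [ih, ih]
    push_cast
    rw [show x + -1 + -(l:ℤ) = x + -((l:ℤ)+1) by ring,
      show x + -((l:ℤ)+1) + 1 = x + -(l:ℤ) by ring, pow_succ]
    ring

lemma conj_apply (p : ℕ) (M : Matrix (Fin p) (Fin p) ℝ) (k l : Fin p) :
    (PP p * M * (PP p).transpose) k l = ∑ i, PP p k i * ∑ j, PP p l j * M i j := by
  rw [Matrix.mul_assoc, Matrix.mul_apply]
  apply Finset.sum_congr rfl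
  intro i _
  rw [Matrix.mul_apply]
  congr 1
  apply Finset.sum_congr rfl
  intro j _
  rw [Matrix.transpose_apply]; ring

lemma conj_one (p n : ℕ) (k l : Fin p) :
    ∑ i : Fin p, PP p k i * ∑ j : Fin p, PP p l j * ff n ((i:ℤ)-(j:ℤ)) =
      (-1)^(l:ℕ) * (fwdDiff (1:ℤ))^[(k:ℕ)+l] (ff n) (-(l:ℤ)) := by
  have h1 : ∀ i : Fin p, ∑ j : Fin p, PP p l j * ff n ((i:ℤ)-(j:ℤ)) =
      (fun x => (-1)^(l:ℕ) * (fwdDiff (1:ℤ))^[(l:ℕ)] (ff n) (x + -(l:ℤ))) (0 + (i:ℕ) • (1:ℤ)) := by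
    intro i
    simp only
    rw [← dd_neg, ← PP_sum]
    apply Finset.sum_congr rfl
    intro j _
    congr 2; simp; ring
  rw [Finset.sum_congr rfl (fun i _ => by rw [h1 i])]
  refine (PP_sum p k (fun x => (-1)^(l:ℕ) * (fwdDiff (1:ℤ))^[(l:ℕ)] (ff n) (x + -(l:ℤ))) 1 0).trans ?_
  rw [dd_shift, ← Function.iterate_add_apply, zero_add]

lemma conj_two (p n : ℕ) (h : ℤ) (k l : Fin p) :
    ∑ i : Fin p, PP p k i * ∑ j : Fin p, PP p l j * ff n (h-(i:ℤ)-(j:ℤ)) =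
      (-1)^((k:ℕ)+(l:ℕ)) * (fwdDiff (1:ℤ))^[(k:ℕ)+l] (ff n) (h + -(((k:ℕ)+(l:ℕ):ℕ):ℤ)) := by
  have h1 : ∀ i : Fin p, ∑ j : Fin p, PP p l j * ff n (h-(i:ℤ)-(j:ℤ)) =
      (fwdDiff (-1:ℤ))^[(l:ℕ)] (ff n) (h + (i:ℕ) • (-1:ℤ)) := by
    intro i
    rw [← PP_sum]
    apply Finset.sum_congr rfl
    intro j _
    congr 2; simp; ring
  rw [Finset.sum_congr rfl (fun i _ => by rw [h1 i]), PP_sum, 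
    ← Function.iterate_add_apply, dd_neg]

/-- rescaled conjugated matrix -/
noncomputable def EE (p n : ℕ) (M : Matrix (Fin p) (Fin p) ℝ) : Matrix (Fin p) (Fin p) ℝ :=
  Matrix.diagonal (fun k : Fin p => Real.sqrt n ^ (k:ℕ)) * (PP p * M * (PP p).transpose) *
    Matrix.diagonal (fun l : Fin p => Real.sqrt n ^ (l:ℕ) / ff n 0)

lemma EE_apply (p n : ℕ) (M : Matrix (Fin p) (Fin p) ℝ) (k l : Fin p) :
    EE p n M k l = (∑ i, PP p k i * ∑ j, PP p l j * M i j) * Real.sqrt n ^ ((k:ℕ)+l) / ff n 0 := by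
  unfold EE
  rw [Matrix.mul_diagonal, Matrix.diagonal_mul, conj_apply, pow_add]
  ring

lemma EE_det (p n : ℕ) (hn : 0 < n) : ∃ c : ℝ, c ≠ 0 ∧ ∀ M, (EE p n M).det = c * M.det := by
  have hn' : (0:ℝ) < n := by exact_mod_cast hn
  have hs : 0 < Real.sqrt n := Real.sqrt_pos.mpr hn'
  have hf := ff_pos n
  refine ⟨(∏ k : Fin p, Real.sqrt n ^ (k:ℕ)) * ∏ l : Fin p, Real.sqrt n ^ (l:ℕ) / ff n 0, ?_, ?_⟩
  · positivity
  · intro M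
    unfold EE
    rw [Matrix.det_mul, Matrix.det_mul, Matrix.det_mul, Matrix.det_mul, Matrix.det_transpose,
      PP_det, Matrix.det_diagonal, Matrix.det_diagonal]
    ring

lemma app_one (p : ℕ) (k l : Fin p) :
    App (fun n => EE p n (Matrix.of fun i j : Fin p => ff n ((i:ℤ)-(j:ℤ))) k l)
      ((-1)^(k:ℕ) * hermiteH ((k:ℕ)+l) 0) := by
  have hx : App (fun n => (((fun _ : ℕ => -(l:ℤ)) n : ℤ) : ℝ) * (Real.sqrt n)⁻¹) 0 := by
    simpa using App.rt.cmul (((-(l:ℤ) : ℤ)) : ℝ)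
  have h := ((FF_app _ 0 hx ((k:ℕ)+l)).1).cmul ((-1)^(l:ℕ))
  have e : (-1:ℝ)^(l:ℕ) * ((-1)^((k:ℕ)+l) * hermiteH ((k:ℕ)+l) 0 * Real.exp (-0^2)) =
      (-1)^(k:ℕ) * hermiteH ((k:ℕ)+l) 0 := by
    have : (-1:ℝ)^(l:ℕ) * (-1)^(l:ℕ) = 1 := by rw [← mul_pow]; norm_num
    rw [pow_add]
    simp only [ne_eq, OfNat.ofNat_ne_zero, not_false_eq_true, zero_pow, neg_zero, Real.exp_zero]
    linear_combination ((-1)^(k:ℕ) * hermiteH ((k:ℕ)+l) 0) * this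
  rw [e] at h
  refine h.congr (Eventually.of_forall fun n => ?_)
  rw [EE_apply]
  simp only [Matrix.of_apply]
  rw [conj_one, FF]
  ring

lemma app_two (p : ℕ) (t : ℝ) (k l : Fin p) :
    App (fun n => EE p n (Matrix.of fun i j : Fin p =>
        ff n ((i:ℤ)-(j:ℤ)) - ff n (⌊t * Real.sqrt n⌋ - i - j)) k l)
      ((-1)^(k:ℕ) * hermiteH ((k:ℕ)+l) 0 - hermiteH ((k:ℕ)+l) t * Real.exp (-t^2)) := by
  have hx : App (fun n : ℕ => (((fun n : ℕ => ⌊t * Real.sqrt n⌋ + -(((k:ℕ)+(l:ℕ):ℕ):ℤ)) n : ℤ) : ℝ)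
      * (Real.sqrt n)⁻¹) t := by
    unfold App
    refine Asymptotics.IsBigO.of_bound (1 + ((k:ℕ)+(l:ℕ):ℕ)) ?_
    filter_upwards [eventually_gt_atTop 0] with n hn0
    have hn' : (0:ℝ) < n := by exact_mod_cast hn0
    have hs : 0 < Real.sqrt n := Real.sqrt_pos.mpr hn'
    have h1 := Int.floor_le (t * Real.sqrt n)
    have h2 := Int.lt_floor_add_one (t * Real.sqrt n)
    have e : (((⌊t * Real.sqrt n⌋ + -(((k:ℕ)+(l:ℕ):ℕ):ℤ) : ℤ)) : ℝ) * (Real.sqrt n)⁻¹ - t =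
      ((⌊t * Real.sqrt n⌋ : ℝ) - (((k:ℕ)+(l:ℕ):ℕ):ℝ) - t * Real.sqrt n) * (Real.sqrt n)⁻¹ := by
      push_cast
      field_simp
      ring
    rw [e, norm_mul]
    gcongr
    rw [Real.norm_eq_abs, abs_le]
    have h3 : (0:ℝ) ≤ (((k:ℕ)+(l:ℕ):ℕ):ℝ) := Nat.cast_nonneg _
    constructor <;> linarith
  have h := ((FF_app _ t hx ((k:ℕ)+l)).1).cmul ((-1)^((k:ℕ)+(l:ℕ)))
  have e : (-1:ℝ)^((k:ℕ)+(l:ℕ)) * ((-1)^((k:ℕ)+l) * hermiteH ((k:ℕ)+l) t * Real.exp (-t^2)) =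
      hermiteH ((k:ℕ)+l) t * Real.exp (-t^2) := by
    have : (-1:ℝ)^((k:ℕ)+(l:ℕ)) * (-1)^((k:ℕ)+(l:ℕ)) = 1 := by rw [← mul_pow]; norm_num
    linear_combination (hermiteH ((k:ℕ)+l) t * Real.exp (-t^2)) * this
  rw [e] at h
  refine ((app_one p k l).sub h).congr (Eventually.of_forall fun n => ?_)
  rw [EE_apply, EE_apply]
  simp only [Matrix.of_apply]
  simp only [mul_sub, Finset.sum_sub_distrib]
  rw [conj_two, FF]
  ring

/-- Weak limit (with speed) of the height of a random `p`-watermelon: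
`P{(H_{n,p}+1)/√n ≤ t}` equals the determinantal limit up to `O(n^{-1/2} e^{-t²})`. -/
theorem stmt6 (p : ℕ) (hp : 0 < p) (t : ℝ) (ht : 0 < t) :
    ∃ C : ℝ, ∃ n0 : ℕ, ∀ n : ℕ, n0 ≤ n →
      |(Nat.card {y : Fin p → Fin (2*n+1) → ℤ //
            IsMelon p n y ∧ ((melonHeight y : ℝ) + 1)/Real.sqrt n ≤ t} : ℝ) /
          (Nat.card {y : Fin p → Fin (2*n+1) → ℤ // IsMelon p n y} : ℝ)
        - (((2:ℝ)^(p.choose 2))⁻¹ / ∏ j ∈ Finset.range p, (j.factorial : ℝ)) *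
            Matrix.det (Matrix.of fun i j : Fin p =>
              (-1:ℝ)^(i : ℕ) * hermiteH ((i : ℕ)+(j : ℕ)) 0
                - hermiteH ((i : ℕ)+(j : ℕ)) t * Real.exp (-t^2))|
      ≤ C * (Real.sqrt n)⁻¹ * Real.exp (-t^2) := by
  have A1 := App.det (B := Matrix.of fun i j : Fin p =>
              (-1:ℝ)^(i : ℕ) * hermiteH ((i : ℕ)+(j : ℕ)) 0
                - hermiteH ((i : ℕ)+(j : ℕ)) t * Real.exp (-t^2)) (app_two p t)
  have A2 := App.det (B := Matrix.of fun i j : Fin p =>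
              (-1:ℝ)^(i : ℕ) * hermiteH ((i : ℕ)+(j : ℕ)) 0) (app_one p)
  have hd : Matrix.det (Matrix.of fun i j : Fin p =>
      (-1:ℝ)^(i : ℕ) * hermiteH ((i : ℕ)+(j : ℕ)) 0) ≠ 0 := by
    rw [det_herm]
    have : 0 < ∏ j ∈ Finset.range p, (j.factorial : ℝ) := Finset.prod_pos (fun j _ => by positivity)
    positivity
  have A3 := A1.mul (A2.inv hd)
  have hlim : ∀ᶠ n : ℕ in atTop, 2 * (p:ℤ) ≤ ⌊t * Real.sqrt n⌋ := by
    have : Tendsto (fun n : ℕ => t * Real.sqrt n) atTop atTop :=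
      (Real.tendsto_sqrt_atTop.comp tendsto_natCast_atTop_atTop).const_mul_atTop ht
    filter_upwards [this.eventually_ge_atTop (2 * (p:ℝ))] with n hn
    rw [Int.le_floor]
    push_cast
    exact hn
  have A4 := A3.congr (v := fun n => (Nat.card {y : Fin p → Fin (2*n+1) → ℤ //
            IsMelon p n y ∧ ((melonHeight y : ℝ) + 1)/Real.sqrt n ≤ t} : ℝ) /
          (Nat.card {y : Fin p → Fin (2*n+1) → ℤ // IsMelon p n y} : ℝ)) (by
    filter_upwards [hlim, eventually_gt_atTop 0] with n hn hn0
    have e1 : Nat.card {y : Fin p → Fin (2*n+1) → ℤ //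
            IsMelon p n y ∧ ((melonHeight y : ℝ) + 1)/Real.sqrt n ≤ t} =
        Nat.card {y : Fin p → Fin (2*n+1) → ℤ //
            IsMelon p n y ∧ ∀ i s, y i s < ⌊t * Real.sqrt n⌋} := by
      apply Nat.card_congr
      apply Equiv.subtypeEquivRight
      intro y
      rw [height_iff hp hn0]
    rw [e1, count_h p n _ hn, count_all]
    obtain ⟨c, hc, hE⟩ := EE_det p n hn0
    rw [hE, hE, mul_inv, ← div_eq_mul_inv]
    rw [show ∀ a b : ℝ, c * a * (c⁻¹ / b) = a / b from fun a b => by field_simp]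
    rfl)

  have A5 := Asymptotics.IsBigO.bound A4
  obtain ⟨C, hC⟩ := A5
  obtain ⟨n0, hn0⟩ := eventually_atTop.mp hC
  refine ⟨C / Real.exp (-t^2), n0, fun n hn => ?_⟩
  have h := hn0 n hn
  rw [Real.norm_eq_abs, Real.norm_eq_abs, abs_of_nonneg (by positivity : (0:ℝ) ≤ (Real.sqrt n)⁻¹)] at h
  have hexp := (Real.exp_pos (-t^2)).ne'
  rw [show C / Real.exp (-t^2) * (Real.sqrt n)⁻¹ * Real.exp (-t^2) = C * (Real.sqrt n)⁻¹ by
    field_simp]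
  refine le_trans (le_of_eq ?_) h
  congr 2
  rw [det_herm, mul_inv]
  simp only [div_eq_mul_inv]
  exact mul_comm _ _
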